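/- arXiv:1609.07337 — 2 statements merged into one kernel-verified Lean document; each statement's English description precedes it below -/
import Mathlib

section
/- Let U : X → ℝ ∪ {+∞} be proper, convex and lower semicontinuous, let Ω ⊆ X be a nonempty closed convex set, and for α > 0 define V_α : X → ℝ ∪ {+∞} by V_α(x) := U_α(x) + (1/(2α)) d_H(x,Ω)² (interpreted as +∞ when d_H(x,Ω) = +∞), where U_α is the Moreau–Yosida approximation of U along H. Then for every x ∈ X: if x ∈ Ω then lim_{α→0⁺} V_α(x) = U(x), and if x ∉ Ω then lim_{α→0⁺} V_α(x) = +∞ (limits taken in ℝ ∪ {+∞}). -/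
open scoped ENNReal RealInnerProductSpace
open Filter Topology

variable {X H : Type*}
  [NormedAddCommGroup X] [NormedSpace ℝ X] [CompleteSpace X]
  [NormedAddCommGroup H] [InnerProductSpace ℝ H] [CompleteSpace H]

/-- The distance along `H` from `x` to the set `C`, valued in `[0, +∞]`
(the infimum over the empty set being `+∞`). -/
noncomputable def dH (ι : H →L[ℝ] X) (C : Set X) (x : X) : ℝ≥0∞ :=
  ⨅ h ∈ {h : H | x - ι h ∈ C}, ENNReal.ofReal ‖h‖

/-- The set `D(C)` of points `x ∈ X` such that `H ∩ (x - C) ≠ ∅`. -/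
def DSet (ι : H →L[ℝ] X) (C : Set X) : Set X := {x : X | ∃ h : H, x - ι h ∈ C}

/-- The Moreau–Yosida approximation along `H` of `f : X → ℝ ∪ {+∞}`
with parameter `α`. -/
noncomputable def moreauYosidaH (ι : H →L[ℝ] X) (f : X → EReal) (α : ℝ) (x : X) : EReal :=
  ⨅ h : H, f (x + ι h) + (((1 / (2 * α)) * ‖h‖ ^ 2 : ℝ) : EReal)

/-- The penalized weight `V_α(x) = U_α(x) + (1/(2α)) d_H(x, Ω)²`, interpreted as `+∞`
when `d_H(x, Ω) = +∞`. -/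
noncomputable def penalizedWeight (ι : H →L[ℝ] X) (U : X → EReal) (Ω : Set X) (α : ℝ)
    (x : X) : EReal :=
  moreauYosidaH ι U α x + (((1 / (2 * α)) : ℝ) : EReal) * (dH ι Ω x ^ 2 : ℝ≥0∞).toEReal

/-- A proper, convex, lower semicontinuous function decreases at most linearly. -/
lemma exists_linear_lower_bound {E : Type*} [NormedAddCommGroup E] [NormedSpace ℝ E]
    {U : E → EReal} (hbot : ∀ y : E, U y ≠ ⊥) (hproper : ∃ y : E, U y ≠ ⊤)
    (hconv : ∀ (x y : E) (a b : ℝ), 0 ≤ a → 0 ≤ b → a + b = 1 →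
      U (a • x + b • y) ≤ (a : EReal) * U x + (b : EReal) * U y)
    (hlsc : LowerSemicontinuous U) :
    ∃ A B : ℝ, 0 ≤ B ∧ ∀ y : E, ((A - B * ‖y‖ : ℝ) : EReal) ≤ U y := by
  obtain ⟨p, hp⟩ := hproper
  obtain ⟨u, hu⟩ : ∃ u : ℝ, U p = u := ⟨_, (EReal.coe_toReal hp (hbot p)).symm⟩
  have hlt : ((u - 1 : ℝ) : EReal) < U p := by
    rw [hu, EReal.coe_lt_coe_iff]; linarith
  obtain ⟨r, hr, hball⟩ := Metric.eventually_nhds_iff.1 (hlsc p _ hlt)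
  obtain ⟨s, hs, hsr⟩ := exists_between hr
  have key : ∀ y : E, ((u - 1 - ‖y - p‖ / s : ℝ) : EReal) ≤ U y := by
    intro y
    by_cases hy : ‖y - p‖ < r
    · refine le_trans ?_ (hball (by rwa [dist_eq_norm])).le
      rw [EReal.coe_le_coe_iff]
      have : 0 ≤ ‖y - p‖ / s := by positivity
      linarith
    · by_cases hyt : U y = ⊤
      · simp [hyt]
      obtain ⟨v, hv⟩ : ∃ v : ℝ, U y = v := ⟨_, (EReal.coe_toReal hyt (hbot y)).symm⟩
      have hn : 0 < ‖y - p‖ := by linarith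
      set t := s / ‖y - p‖ with ht
      have ht0 : 0 < t := by positivity
      have ht1 : t ≤ 1 := by rw [ht, div_le_one hn]; linarith
      have hz : dist ((1 - t) • p + t • y) p < r := by
        have : (1 - t) • p + t • y - p = t • (y - p) := by module
        rw [dist_eq_norm, this, norm_smul, Real.norm_of_nonneg ht0.le, ht,
          div_mul_cancel₀ _ hn.ne']
        exact hsr
      have h := (hball hz).trans_le (hconv p y (1 - t) t (by linarith) ht0.le (by ring))
      rw [hu, hv] at h
      have h' : u - 1 < (1 - t) * u + t * v := by exact_mod_cast h
      rw [hv, EReal.coe_le_coe_iff]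
      have hts : t * (‖y - p‖ / s) = 1 := by rw [ht]; field_simp
      refine le_of_mul_le_mul_left ?_ ht0
      linarith [mul_sub t (u - 1) (‖y - p‖ / s), mul_sub t u 1]
  refine ⟨u - 1 - ‖p‖ / s, 1 / s, by positivity, fun y => le_trans ?_ (key y)⟩
  rw [EReal.coe_le_coe_iff]
  have : ‖y - p‖ / s ≤ (‖y‖ + ‖p‖) / s := by gcongr; exact norm_sub_le y p
  rw [add_div] at this
  rw [one_div_mul_eq_div]
  linarith

/-- Around any point, the images `ι h` of all small `h` stay in a given neighbourhood. -/
lemma exists_pos_forall_norm_lt_of_eventually {E F : Type*} [NormedAddCommGroup E]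
    [NormedSpace ℝ E] [NormedAddCommGroup F] [NormedSpace ℝ F] (ι : F →L[ℝ] E)
    {P : E → Prop} {x : E} (hP : ∀ᶠ y in 𝓝 x, P y) :
    ∃ δ > 0, ∀ h : F, ‖h‖ < δ → P (x + ι h) := by
  have hc : Tendsto (fun h : F => x + ι h) (𝓝 0) (𝓝 x) :=
    (show Continuous fun h : F => x + ι h by fun_prop).tendsto' 0 x (by simp)
  obtain ⟨δ, hδ, h⟩ := Metric.eventually_nhds_iff.1 (hc.eventually hP)
  exact ⟨δ, hδ, fun k hk => h (by simpa using hk)⟩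

lemma tendsto_one_div_two_mul_nhdsGT_zero :
    Tendsto (fun α : ℝ => 1 / (2 * α)) (𝓝[>] 0) atTop := by
  have h := tendsto_inv_nhdsGT_zero (𝕜 := ℝ) |>.const_mul_atTop (r := 1 / 2) (by norm_num)
  refine h.congr fun α => ?_
  rw [one_div_mul_eq_div, one_div, mul_inv, div_eq_inv_mul]

lemma eventually_le_moreauYosidaH {E F : Type*} [NormedAddCommGroup E] [NormedSpace ℝ E]
    [NormedAddCommGroup F] [InnerProductSpace ℝ F] (ι : F →L[ℝ] E)
    {U : E → EReal} (hbot : ∀ y : E, U y ≠ ⊥) (hproper : ∃ y : E, U y ≠ ⊤)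
    (hconv : ∀ (x y : E) (a b : ℝ), 0 ≤ a → 0 ≤ b → a + b = 1 →
      U (a • x + b • y) ≤ (a : EReal) * U x + (b : EReal) * U y)
    (hlsc : LowerSemicontinuous U) {x : E} {a : ℝ} (ha : (a : EReal) < U x) :
    ∀ᶠ α in 𝓝[>] (0 : ℝ), (a : EReal) ≤ moreauYosidaH ι U α x := by
  obtain ⟨A, B, hB, hAB⟩ := exists_linear_lower_bound hbot hproper hconv hlsc
  obtain ⟨δ, hδ, hnear⟩ := exists_pos_forall_norm_lt_of_eventually ι (hlsc x _ ha)
  set K := |a - A + B * ‖x‖| with hK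
  filter_upwards [tendsto_one_div_two_mul_nhdsGT_zero.eventually_ge_atTop
    ((B * ‖ι‖ + K / δ) / δ)] with α hα
  refine le_iInf fun h => ?_
  generalize 1 / (2 * α) = c at hα ⊢
  have hc : 0 ≤ c := le_trans (by positivity) hα
  by_cases hh : ‖h‖ < δ
  · refine (hnear h hh).le.trans (le_add_of_nonneg_right ?_)
    exact_mod_cast (by positivity : 0 ≤ c * ‖h‖ ^ 2)
  · rw [not_lt] at hh
    refine le_trans ?_ (add_le_add_left (hAB (x + ι h)) _)
    rw [← EReal.coe_add, EReal.coe_le_coe_iff]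
    have h1 : B * ‖x + ι h‖ ≤ B * (‖x‖ + ‖ι‖ * ‖h‖) := by
      gcongr
      exact (norm_add_le _ _).trans (by gcongr; exact ι.le_opNorm h)
    have h2 : B * ‖ι‖ + K / δ ≤ c * ‖h‖ :=
      ((div_le_iff₀ hδ).1 hα).trans (by gcongr)
    have h3 : (B * ‖ι‖ + K / δ) * ‖h‖ ≤ c * ‖h‖ * ‖h‖ := by gcongr
    have h4 : K ≤ K / δ * ‖h‖ := by
      rw [div_mul_eq_mul_div, le_div_iff₀ hδ]; gcongr
    have h5 : a - A + B * ‖x‖ ≤ K := le_abs_self _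
    nlinarith

lemma moreauYosidaH_le {E F : Type*} [NormedAddCommGroup E] [NormedSpace ℝ E]
    [NormedAddCommGroup F] [InnerProductSpace ℝ F] (ι : F →L[ℝ] E)
    (f : E → EReal) (α : ℝ) (x : E) : moreauYosidaH ι f α x ≤ f x :=
  (iInf_le _ 0).trans (by simp)

lemma dH_eq_zero_of_mem {E F : Type*} [NormedAddCommGroup E] [NormedSpace ℝ E]
    [NormedAddCommGroup F] [InnerProductSpace ℝ F] (ι : F →L[ℝ] E)
    {C : Set E} {x : E} (hx : x ∈ C) : dH ι C x = 0 :=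
  le_antisymm ((iInf₂_le (0 : F) (by simpa using hx)).trans (by simp)) zero_le

lemma exists_pos_le_dH_of_notMem {E F : Type*} [NormedAddCommGroup E] [NormedSpace ℝ E]
    [NormedAddCommGroup F] [InnerProductSpace ℝ F] (ι : F →L[ℝ] E)
    {C : Set E} (hC : IsClosed C) {x : E} (hx : x ∉ C) :
    ∃ δ : ℝ, 0 < δ ∧ ENNReal.ofReal δ ≤ dH ι C x := by
  obtain ⟨δ, hδ, hnear⟩ :=
    exists_pos_forall_norm_lt_of_eventually ι (hC.isOpen_compl.eventually_mem hx)
  refine ⟨δ, hδ, le_iInf₂ fun h hh => ENNReal.ofReal_le_ofReal (not_lt.1 fun hlt => ?_)⟩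
  refine hnear (-h) (by rwa [norm_neg]) ?_
  simpa [← sub_eq_add_neg] using hh

/-- Let `U : X → ℝ ∪ {+∞}` be proper, convex and lower semicontinuous,
`Ω ⊆ X` a nonempty closed convex set, and `V_α(x) = U_α(x) + (1/(2α)) d_H(x,Ω)²`. Then for
every `x ∈ X`: if `x ∈ Ω` then `V_α(x) → U(x)` as `α → 0⁺`, and if `x ∉ Ω` then
`V_α(x) → +∞` as `α → 0⁺`. -/
theorem penalizedWeight_tendsto (ι : H →L[ℝ] X) (hι : Function.Injective ι)
    (U : X → EReal) (hbot : ∀ y : X, U y ≠ ⊥) (hproper : ∃ y : X, U y ≠ ⊤)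
    (hconv : ∀ (x y : X) (a b : ℝ), 0 ≤ a → 0 ≤ b → a + b = 1 →
      U (a • x + b • y) ≤ (a : EReal) * U x + (b : EReal) * U y)
    (hlsc : LowerSemicontinuous U)
    (Ω : Set X) (hΩne : Ω.Nonempty) (hΩclosed : IsClosed Ω) (hΩconv : Convex ℝ Ω) :
    ∀ x : X,
      (x ∈ Ω →
        Tendsto (fun α : ℝ => penalizedWeight ι U Ω α x) (𝓝[>] 0) (𝓝 (U x))) ∧
      (x ∉ Ω →
        Tendsto (fun α : ℝ => penalizedWeight ι U Ω α x) (𝓝[>] 0) (𝓝 ⊤)) := by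
  intro x
  refine ⟨fun hx => ?_, fun hx => ?_⟩
  · have heq : ∀ α : ℝ, penalizedWeight ι U Ω α x = moreauYosidaH ι U α x := fun α => by
      simp [penalizedWeight, dH_eq_zero_of_mem ι hx]
    simp only [heq]
    refine tendsto_order.2 ⟨fun b hb => ?_, fun b hb =>
      Eventually.of_forall fun α => (moreauYosidaH_le ι U α x).trans_lt hb⟩
    obtain ⟨a, hba, hax⟩ := EReal.lt_iff_exists_real_btwn.1 hb
    filter_upwards [eventually_le_moreauYosidaH ι hbot hproper hconv hlsc hax] with α hα
    exact hba.trans_le hα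
  · obtain ⟨δ, hδ, hdist⟩ := exists_pos_le_dH_of_notMem ι hΩclosed hx
    obtain ⟨a, -, hax⟩ := EReal.lt_iff_exists_real_btwn.1 (bot_lt_iff_ne_bot.2 (hbot x))
    rw [EReal.tendsto_nhds_top_iff_real]
    intro M
    have hlim : Tendsto (fun α : ℝ => a + 1 / (2 * α) * δ ^ 2) (𝓝[>] 0) atTop :=
      tendsto_atTop_add_const_left _ _
        (tendsto_one_div_two_mul_nhdsGT_zero.atTop_mul_const (by positivity))
    filter_upwards [eventually_le_moreauYosidaH ι hbot hproper hconv hlsc hax,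
      hlim.eventually_gt_atTop M, self_mem_nhdsWithin] with α hα hM hpos
    have hpos' : (0 : ℝ) < α := hpos
    have hsq : ((δ ^ 2 : ℝ) : EReal) ≤ ((dH ι Ω x ^ 2 : ℝ≥0∞) : EReal) := by
      have h : ENNReal.ofReal (δ ^ 2) ≤ dH ι Ω x ^ 2 := by
        rw [ENNReal.ofReal_pow hδ.le]; gcongr
      have h' := EReal.coe_ennreal_le_coe_ennreal_iff.2 h
      rwa [EReal.coe_ennreal_ofReal, max_eq_left (sq_nonneg δ)] at h'
    calc (M : EReal) < ((a + 1 / (2 * α) * δ ^ 2 : ℝ) : EReal) := EReal.coe_lt_coe_iff.2 hM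
      _ = (a : EReal) + ((1 / (2 * α) : ℝ) : EReal) * ((δ ^ 2 : ℝ) : EReal) := by
        rw [EReal.coe_add, EReal.coe_mul]
      _ ≤ penalizedWeight ι U Ω α x :=
        add_le_add hα (mul_le_mul_of_nonneg_left hsq
          (EReal.coe_nonneg.2 (by positivity)))
end

section
/- Let U : X → ℝ ∪ {+∞} be proper, convex and lower semicontinuous, let Ω ⊆ X be a nonempty closed convex set, let α > 0, and define V_α : X → ℝ ∪ {+∞} by V_α(x) := U_α(x) + (1/(2α)) d_H(x,Ω)² (interpreted as +∞ when d_H(x,Ω) = +∞), where U_α is the Moreau–Yosida approximation of U along H. Then V_α is convex on X (as an extended-real-valued function), and for every x ∈ D(Ω) such that U(x + ιh₀) < +∞ for some h₀ ∈ H, the map h ↦ V_α(x + ιh) is real-valued and continuous on H (V_α is H-continuous at such points). -/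
open scoped ENNReal RealInnerProductSpace
open Filter Topology

variable {X H : Type*}
  [NormedAddCommGroup X] [NormedSpace ℝ X] [CompleteSpace X]
  [NormedAddCommGroup H] [InnerProductSpace ℝ H] [CompleteSpace H]

/-- A proper convex lower semicontinuous function has a continuous affine minorant. -/
theorem exists_continuous_affine_le {E : Type*} [NormedAddCommGroup E] [NormedSpace ℝ E]
    {f : E → EReal} (hbot : ∀ y, f y ≠ ⊥) (hproper : ∃ y, f y ≠ ⊤)
    (hconv : ∀ (x y : E) (a b : ℝ), 0 ≤ a → 0 ≤ b → a + b = 1 →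
      f (a • x + b • y) ≤ (a : EReal) * f x + (b : EReal) * f y)
    (hlsc : LowerSemicontinuous f) :
    ∃ (l : E →L[ℝ] ℝ) (β : ℝ), ∀ y, ((l y + β : ℝ) : EReal) ≤ f y := by
  obtain ⟨y₀, hy₀⟩ := hproper
  lift f y₀ to ℝ using ⟨hy₀, hbot y₀⟩ with u₀ hu₀
  let S : Set (E × ℝ) := {p | f p.1 ≤ (p.2 : EReal)}
  have hSclosed : IsClosed S :=
    hlsc.isClosed_epigraph.preimage
      (continuous_fst.prodMk (continuous_coe_real_ereal.comp continuous_snd))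
  have hSconv : Convex ℝ S := by
    rintro ⟨x, r⟩ hx ⟨y, s⟩ hy a b ha hb hab
    have hx : f x ≤ r := hx
    have hy : f y ≤ s := hy
    change f (a • x + b • y) ≤ ((a * r + b * s : ℝ) : EReal)
    refine (hconv x y a b ha hb hab).trans ?_
    push_cast
    gcongr
  have hnot : (y₀, u₀ - 1) ∉ S := by
    change ¬ f y₀ ≤ ((u₀ - 1 : ℝ) : EReal)
    rw [← hu₀, EReal.coe_le_coe_iff]
    linarith
  obtain ⟨φ, c, hφ₀, hφ⟩ := geometric_hahn_banach_point_closed hSconv hSclosed hnot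
  have hsplit : ∀ y r, φ (y, r) = φ (y, 0) + r * φ (0, 1) := by
    intro y r
    have : ((y, r) : E × ℝ) = (y, 0) + r • (0, 1) := by simp
    rw [this, map_add, map_smul, smul_eq_mul]
  have hmem₀ : (y₀, u₀) ∈ S := hu₀.ge
  have hpos : 0 < φ (0, 1) := by
    have h := hφ₀.trans (hφ _ hmem₀)
    rw [hsplit y₀ (u₀ - 1), hsplit y₀ u₀] at h
    linarith
  refine ⟨-(φ (0, 1))⁻¹ • φ.comp (ContinuousLinearMap.inl ℝ E ℝ), c / φ (0, 1), fun y => ?_⟩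
  by_cases hy : f y = ⊤
  · simp [hy]
  lift f y to ℝ using ⟨hy, hbot y⟩ with r hr
  have h := hφ (y, r) hr.ge
  rw [hsplit] at h
  simp only [EReal.coe_le_coe_iff, smul_apply, ContinuousLinearMap.comp_apply,
    ContinuousLinearMap.inl_apply, smul_eq_mul]
  rw [show -(φ (0, 1))⁻¹ * φ (y, 0) + c / φ (0, 1) = (c - φ (y, 0)) / φ (0, 1) by
    field_simp; ring, div_le_iff₀ hpos]
  linarith

/-- Convexity of an extended-real-valued function follows from convexity of its strict epigraph. -/
theorem EReal.convex_of_forall_lt {E : Type*} [AddCommGroup E] [Module ℝ E] {f : E → EReal}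
    (hbot : ∀ y, f y ≠ ⊥)
    (h : ∀ (x y : E) (a b r s : ℝ), 0 < a → 0 < b → a + b = 1 → f x < r → f y < s →
      f (a • x + b • y) ≤ ((a * r + b * s : ℝ) : EReal))
    (x y : E) (a b : ℝ) (ha : 0 ≤ a) (hb : 0 ≤ b) (hab : a + b = 1) :
    f (a • x + b • y) ≤ (a : EReal) * f x + (b : EReal) * f y := by
  rcases ha.eq_or_lt with rfl | ha
  · obtain rfl : b = 1 := by linarith
    simp
  rcases hb.eq_or_lt with rfl | hb
  · obtain rfl : a = 1 := by linarith
    simp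
  have hne : ∀ (t : ℝ) (z : E), 0 < t → (t : EReal) * f z ≠ ⊥ := fun t z ht => by
    cases hz : f z with
    | bot => exact absurd hz (hbot z)
    | coe q => exact EReal.coe_ne_bot (t * q)
    | top => simp [EReal.coe_mul_top_of_pos ht]
  by_cases hx : f x = ⊤
  · rw [hx, EReal.coe_mul_top_of_pos ha, EReal.top_add_of_ne_bot (hne b y hb)]
    exact le_top
  by_cases hy : f y = ⊤
  · rw [hy, EReal.coe_mul_top_of_pos hb, EReal.add_top_of_ne_bot (hne a x ha)]
    exact le_top
  have h := h x y a b
  lift f x to ℝ using ⟨hx, hbot x⟩ with p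
  lift f y to ℝ using ⟨hy, hbot y⟩ with q
  have hcast : (a : EReal) * p + (b : EReal) * q = ((a * p + b * q : ℝ) : EReal) := by push_cast; rfl
  rw [hcast]
  refine EReal.le_of_forall_lt_iff_le.mp fun t ht => ?_
  rw [EReal.coe_lt_coe_iff] at ht
  convert h (p + (t - (a * p + b * q))) (q + (t - (a * p + b * q))) ha hb hab
    (by rw [EReal.coe_lt_coe_iff]; linarith) (by rw [EReal.coe_lt_coe_iff]; linarith) using 2
  linear_combination (t - (a * p + b * q)) * (-hab)

/-- The convexity inequality for the squared norm. -/
theorem norm_sq_convex_combination_le {E : Type*} [SeminormedAddCommGroup E] [NormedSpace ℝ E]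
    (x y : E) {a b : ℝ} (ha : 0 ≤ a) (hb : 0 ≤ b) (hab : a + b = 1) :
    ‖a • x + b • y‖ ^ 2 ≤ a * ‖x‖ ^ 2 + b * ‖y‖ ^ 2 := by
  have h := ((convexOn_univ_norm (E := E)).pow (fun _ _ => norm_nonneg _) 2).2
    (Set.mem_univ x) (Set.mem_univ y) ha hb hab
  simpa using h

omit [CompleteSpace X] [CompleteSpace H] in
theorem moreauYosidaH_ne_bot (ι : H →L[ℝ] X) {f : X → EReal} {l : X →L[ℝ] ℝ} {β : ℝ}
    (hl : ∀ y, ((l y + β : ℝ) : EReal) ≤ f y) {α : ℝ} (hα : 0 < α) (x : X) :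
    moreauYosidaH ι f α x ≠ ⊥ := by
  set L := l.comp ι
  have hle : ((l x + β - α / 2 * ‖L‖ ^ 2 : ℝ) : EReal) ≤ moreauYosidaH ι f α x := by
    refine le_iInf fun h => ?_
    refine le_trans ?_ (add_le_add_left (hl (x + ι h)) _)
    rw [← EReal.coe_add, EReal.coe_le_coe_iff, map_add]
    have h₁ : -(‖L‖ * ‖h‖) ≤ l (ι h) := (abs_le.mp (L.le_opNorm h)).1
    have h₂ : 1 / (2 * α) * ‖h‖ ^ 2 - ‖L‖ * ‖h‖ + α / 2 * ‖L‖ ^ 2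
        = 1 / (2 * α) * (‖h‖ - α * ‖L‖) ^ 2 := by
      field_simp
      ring
    have h₃ : 0 ≤ 1 / (2 * α) * (‖h‖ - α * ‖L‖) ^ 2 := by positivity
    linarith
  exact ne_bot_of_le_ne_bot (EReal.coe_ne_bot _) hle

theorem EReal.coe_mul_coe_ennreal_nonneg {c : ℝ} (hc : 0 ≤ c) (d : ℝ≥0∞) :
    0 ≤ (c : EReal) * (d : EReal) :=
  mul_nonneg (EReal.coe_nonneg.mpr hc) (EReal.coe_ennreal_nonneg d)

theorem EReal.coe_mul_coe_ennreal_ofReal_sq (c : ℝ) {D : ℝ} (hD : 0 ≤ D) :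
    (c : EReal) * ((ENNReal.ofReal D ^ 2 : ℝ≥0∞) : EReal) = ((c * D ^ 2 : ℝ) : EReal) := by
  rw [← ENNReal.ofReal_pow hD, EReal.coe_ennreal_ofReal, max_eq_left (by positivity),
    EReal.coe_mul]

omit [CompleteSpace X] [CompleteSpace H] in
theorem dH_le (ι : H →L[ℝ] X) {C : Set X} {x : X} {k : H} (hk : x - ι k ∈ C) :
    dH ι C x ≤ ENNReal.ofReal ‖k‖ :=
  iInf₂_le k hk

omit [CompleteSpace X] [CompleteSpace H] in
theorem penalizedWeight_ne_bot (ι : H →L[ℝ] X) {U : X → EReal} {l : X →L[ℝ] ℝ} {β : ℝ}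
    (hl : ∀ y, ((l y + β : ℝ) : EReal) ≤ U y) (Ω : Set X) {α : ℝ} (hα : 0 < α) (x : X) :
    penalizedWeight ι U Ω α x ≠ ⊥ := by
  have h₀ := EReal.coe_mul_coe_ennreal_nonneg (by positivity : 0 ≤ 1 / (2 * α)) (dH ι Ω x ^ 2)
  exact (EReal.bot_lt_add_iff.mpr ⟨bot_lt_iff_ne_bot.mpr (moreauYosidaH_ne_bot ι hl hα x),
    EReal.bot_lt_zero.trans_le h₀⟩).ne'

omit [CompleteSpace X] [CompleteSpace H] in
theorem penalizedWeight_le (ι : H →L[ℝ] X) {U : X → EReal} {Ω : Set X} {α : ℝ} (hα : 0 < α)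
    {x : X} {h k : H} {u : ℝ} (hk : x - ι k ∈ Ω) (hu : U (x + ι h) ≤ u) :
    penalizedWeight ι U Ω α x ≤ ((u + 1 / (2 * α) * (‖h‖ ^ 2 + ‖k‖ ^ 2) : ℝ) : EReal) := by
  have hc : (0 : ℝ) ≤ 1 / (2 * α) := by positivity
  rw [mul_add, ← add_assoc, EReal.coe_add, EReal.coe_add,
    ← EReal.coe_mul_coe_ennreal_ofReal_sq _ (norm_nonneg k)]
  refine add_le_add ((iInf_le _ h).trans (add_le_add_left hu _)) ?_
  exact mul_le_mul_of_nonneg_left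
    (EReal.coe_ennreal_le_coe_ennreal_iff.mpr (pow_le_pow_left₀ zero_le (dH_le ι hk) 2))
    (EReal.coe_nonneg.mpr hc)

omit [CompleteSpace X] [CompleteSpace H] in
theorem exists_of_penalizedWeight_lt (ι : H →L[ℝ] X) {U : X → EReal} (hbot : ∀ y, U y ≠ ⊥)
    {l : X →L[ℝ] ℝ} {β : ℝ} (hl : ∀ y, ((l y + β : ℝ) : EReal) ≤ U y) {Ω : Set X} {α : ℝ}
    (hα : 0 < α) {x : X} {r : ℝ} (hr : penalizedWeight ι U Ω α x < r) :
    ∃ (h k : H) (u : ℝ), x - ι k ∈ Ω ∧ U (x + ι h) ≤ u ∧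
      u + 1 / (2 * α) * (‖h‖ ^ 2 + ‖k‖ ^ 2) < r := by
  have hc : (0 : ℝ) < 1 / (2 * α) := by positivity
  have hm := moreauYosidaH_ne_bot ι hl hα x
  unfold penalizedWeight at hr
  generalize hcdef : 1 / (2 * α) = c at *
  have hd : dH ι Ω x ≠ ⊤ := by
    intro hd
    rw [hd, ENNReal.top_pow two_ne_zero, EReal.coe_ennreal_top, EReal.coe_mul_top_of_pos hc,
      EReal.add_top_of_ne_bot hm] at hr
    exact not_top_lt hr
  obtain ⟨D, hD, hdD⟩ : ∃ D : ℝ, 0 ≤ D ∧ dH ι Ω x = ENNReal.ofReal D :=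
    ⟨_, ENNReal.toReal_nonneg, (ENNReal.ofReal_toReal hd).symm⟩
  rw [hdD, EReal.coe_mul_coe_ennreal_ofReal_sq _ hD] at hr
  have hmt : moreauYosidaH ι U α x ≠ ⊤ := by
    intro h
    rw [h, EReal.top_add_coe] at hr
    exact not_top_lt hr
  obtain ⟨m, hmm⟩ : ∃ m : ℝ, (m : EReal) = moreauYosidaH ι U α x :=
    ⟨_, EReal.coe_toReal hmt hm⟩
  rw [← hmm, ← EReal.coe_add, EReal.coe_lt_coe_iff] at hr
  set ε := r - (m + c * D ^ 2) with hε
  have hεpos : 0 < ε := by linarith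
  have hlt : moreauYosidaH ι U α x < ((m + ε / 2 : ℝ) : EReal) := by
    rw [← hmm, EReal.coe_lt_coe_iff]
    linarith
  obtain ⟨h, hh⟩ := iInf_lt_iff.mp hlt
  have hUt : U (x + ι h) ≠ ⊤ := by
    intro ht
    rw [ht, EReal.top_add_coe] at hh
    exact not_top_lt hh
  obtain ⟨u, hu⟩ : ∃ u : ℝ, (u : EReal) = U (x + ι h) := ⟨_, EReal.coe_toReal hUt (hbot _)⟩
  rw [← hu, ← EReal.coe_add, EReal.coe_lt_coe_iff, hcdef] at hh
  have hDlt : D < √(D ^ 2 + ε / (2 * c)) :=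
    Real.lt_sqrt_of_sq_lt (lt_add_of_pos_right _ (by positivity))
  have hdlt : dH ι Ω x < ENNReal.ofReal √(D ^ 2 + ε / (2 * c)) := by
    rw [hdD]
    exact (ENNReal.ofReal_lt_ofReal_iff (hD.trans_lt hDlt)).mpr hDlt
  obtain ⟨k, hklt⟩ := iInf_lt_iff.mp hdlt
  obtain ⟨hk, hklt⟩ := iInf_lt_iff.mp hklt
  have hklt : ‖k‖ < √(D ^ 2 + ε / (2 * c)) :=
    (ENNReal.ofReal_lt_ofReal_iff (hD.trans_lt hDlt)).mp hklt
  rw [Real.lt_sqrt (norm_nonneg k)] at hklt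
  refine ⟨h, k, u, hk, hu.ge, ?_⟩
  have hck : c * ‖k‖ ^ 2 < c * (D ^ 2 + ε / (2 * c)) := mul_lt_mul_of_pos_left hklt hc
  have hcε : c * (D ^ 2 + ε / (2 * c)) = c * D ^ 2 + ε / 2 := by field_simp
  linarith

/-- Let `U : X → ℝ ∪ {+∞}` be proper, convex and lower semicontinuous,
`Ω ⊆ X` a nonempty closed convex set, `α > 0`, and
`V_α(x) = U_α(x) + (1/(2α)) d_H(x,Ω)²`. Then `V_α` is convex on `X` (as an extended-real
valued function), and for every `x ∈ D(Ω)` with `U(x + ιh₀) < +∞` for some `h₀ ∈ H`, the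
map `h ↦ V_α(x + ιh)` is real-valued and continuous on `H`. -/
theorem penalizedWeight_convex_and_H_continuous (ι : H →L[ℝ] X) (hι : Function.Injective ι)
    (U : X → EReal) (hbot : ∀ y : X, U y ≠ ⊥) (hproper : ∃ y : X, U y ≠ ⊤)
    (hconv : ∀ (x y : X) (a b : ℝ), 0 ≤ a → 0 ≤ b → a + b = 1 →
      U (a • x + b • y) ≤ (a : EReal) * U x + (b : EReal) * U y)
    (hlsc : LowerSemicontinuous U)
    (Ω : Set X) (hΩne : Ω.Nonempty) (hΩclosed : IsClosed Ω) (hΩconv : Convex ℝ Ω)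
    (α : ℝ) (hα : 0 < α) :
    (∀ (x y : X) (a b : ℝ), 0 ≤ a → 0 ≤ b → a + b = 1 →
        penalizedWeight ι U Ω α (a • x + b • y) ≤
          (a : EReal) * penalizedWeight ι U Ω α x +
            (b : EReal) * penalizedWeight ι U Ω α y) ∧
      ∀ x : X, x ∈ DSet ι Ω → (∃ h₀ : H, U (x + ι h₀) ≠ ⊤) →
        ∃ g : H → ℝ, Continuous g ∧
          ∀ h : H, penalizedWeight ι U Ω α (x + ι h) = ((g h : ℝ) : EReal) := by
  obtain ⟨l, β, hl⟩ := exists_continuous_affine_le hbot hproper hconv hlsc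
  have hVbot := penalizedWeight_ne_bot ι hl Ω hα
  have hVconv := EReal.convex_of_forall_lt hVbot fun x y a b r s ha hb hab hx hy => by
    obtain ⟨h₁, k₁, u₁, hk₁, hu₁, hr⟩ := exists_of_penalizedWeight_lt ι hbot hl hα hx
    obtain ⟨h₂, k₂, u₂, hk₂, hu₂, hs⟩ := exists_of_penalizedWeight_lt ι hbot hl hα hy
    have hk : a • x + b • y - ι (a • k₁ + b • k₂) ∈ Ω := by
      convert hΩconv hk₁ hk₂ ha.le hb.le hab using 1
      simp only [map_add, map_smul, smul_sub]
      abel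
    have hu : U (a • x + b • y + ι (a • h₁ + b • h₂)) ≤ ((a * u₁ + b * u₂ : ℝ) : EReal) := by
      have hsum : a • x + b • y + ι (a • h₁ + b • h₂) = a • (x + ι h₁) + b • (y + ι h₂) := by
        simp only [map_add, map_smul, smul_add]
        abel
      rw [hsum]
      refine (hconv _ _ a b ha.le hb.le hab).trans ?_
      have ha' : (0 : EReal) ≤ a := EReal.coe_nonneg.mpr ha.le
      have hb' : (0 : EReal) ≤ b := EReal.coe_nonneg.mpr hb.le
      push_cast
      exact add_le_add (mul_le_mul_of_nonneg_left hu₁ ha') (mul_le_mul_of_nonneg_left hu₂ hb')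
    refine (penalizedWeight_le ι hα hk hu).trans (EReal.coe_le_coe_iff.mpr ?_)
    have hc : (0 : ℝ) ≤ 1 / (2 * α) := by positivity
    have hnorm := mul_le_mul_of_nonneg_left
      (add_le_add (norm_sq_convex_combination_le h₁ h₂ ha.le hb.le hab)
        (norm_sq_convex_combination_le k₁ k₂ ha.le hb.le hab)) hc
    have har := mul_le_mul_of_nonneg_left hr.le ha.le
    have hbs := mul_le_mul_of_nonneg_left hs.le hb.le
    linarith
  refine ⟨hVconv, ?_⟩
  rintro x ⟨k₀, hk₀⟩ ⟨h₀, hh₀⟩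
  obtain ⟨u₀, hu₀⟩ : ∃ u : ℝ, (u : EReal) = U (x + ι h₀) := ⟨_, EReal.coe_toReal hh₀ (hbot _)⟩
  have hle : ∀ h : H, penalizedWeight ι U Ω α (x + ι h) ≤
      ((u₀ + 1 / (2 * α) * (‖h₀ - h‖ ^ 2 + ‖k₀ + h‖ ^ 2) : ℝ) : EReal) := fun h => by
    refine penalizedWeight_le ι hα ?_ ?_
    · convert hk₀ using 1
      rw [map_add]
      abel
    · rw [map_sub, add_assoc, add_sub_cancel, hu₀]
  have hcoe : ∀ h : H, penalizedWeight ι U Ω α (x + ι h) =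
      ((penalizedWeight ι U Ω α (x + ι h)).toReal : EReal) := fun h =>
    (EReal.coe_toReal (ne_top_of_le_ne_top (EReal.coe_ne_top _) (hle h)) (hVbot _)).symm
  refine ⟨fun h => (penalizedWeight ι U Ω α (x + ι h)).toReal, ?_, hcoe⟩
  have hgconv : ConvexOn ℝ Set.univ
      fun h : H => (penalizedWeight ι U Ω α (x + ι h)).toReal := by
    refine ⟨convex_univ, fun h _ k _ a b ha hb hab => ?_⟩
    have hV := hVconv (x + ι h) (x + ι k) a b ha hb hab
    have hsum : a • (x + ι h) + b • (x + ι k) = x + ι (a • h + b • k) := by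
      rw [smul_add, smul_add, add_add_add_comm, ← add_smul, hab, one_smul, map_add, map_smul,
        map_smul]
    rw [hsum, hcoe (a • h + b • k), hcoe h, hcoe k] at hV
    exact_mod_cast hV
  rw [← continuousOn_univ]
  apply ((hgconv.continuousOn_tfae isOpen_univ Set.univ_nonempty).out 1 3).mpr
  refine ⟨0, Set.mem_univ 0, ?_⟩
  have hcont : Continuous fun h : H =>
      u₀ + 1 / (2 * α) * (‖h₀ - h‖ ^ 2 + ‖k₀ + h‖ ^ 2) := by fun_prop
  refine (hcont.tendsto 0).isBoundedUnder_le.mono_le (Eventually.of_forall fun h => ?_)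
  have hh := hle h
  rw [hcoe h] at hh
  exact EReal.coe_le_coe_iff.mp hh
end
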